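/- α-equivalence under a freshness context is transitive: for any freshness context ∇ and nominal terms t, s, u, if ∇ ⊢ t ≈ s and ∇ ⊢ s ≈ u, then ∇ ⊢ t ≈ u. -/

import Mathlib

set_option maxHeartbeats 1000000
abbrev Atom := ℕ
abbrev Var := ℕ
abbrev Fn := ℕ
abbrev NPerm := List (Atom × Atom)
def swapAtom (a b c : Atom) : Atom := if c = a then b else if c = b then a else c
def permAtom : NPerm → Atom → Atom
  | [], c => c
  | (a, b) :: π, c => swapAtom a b (permAtom π c)
def permInv (π : NPerm) : NPerm := π.reverse
inductive NTerm where
  | app : Fn → List NTerm → NTerm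
  | atom : Atom → NTerm
  | abs : Atom → NTerm → NTerm
  | susp : NPerm → Var → NTerm

def permTerm (π : NPerm) : NTerm → NTerm
  | .app f ts => .app f (ts.attach.map (fun x => permTerm π x.1))
  | .atom a => .atom (permAtom π a)
  | .abs a t => .abs (permAtom π a) (permTerm π t)
  | .susp ρ X => .susp (π ++ ρ) X
decreasing_by
  all_goals (simp_wf; try omega)
  all_goals (have := List.sizeOf_lt_of_mem x.2; omega)

/-- Substitutions (total maps from variables to terms; identity almost everywhere
is not required for the statements). -/
abbrev NSubst := Var → NTerm

def idSubst : NSubst := fun X => .susp [] X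

/-- Application of a substitution to a term (allowing atom capture and forcing
suspended permutations). -/
def substTerm (σ : NSubst) : NTerm → NTerm
  | .app f ts => .app f (ts.attach.map (fun x => substTerm σ x.1))
  | .atom a => .atom a
  | .abs a t => .abs a (substTerm σ t)
  | .susp π X => permTerm π (σ X)
decreasing_by
  all_goals (simp_wf; try omega)
  all_goals (have := List.sizeOf_lt_of_mem x.2; omega)

/-- Composition of substitutions: `t (σθ) = (tσ)θ`. -/
def substComp (σ θ : NSubst) : NSubst := fun X => substTerm θ (σ X)

/-- Freshness contexts: finite sets of constraints `a # X`. -/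
abbrev FCtx := Finset (Atom × Var)

/-- The freshness relation `Δ ⊢ a # t` (Urban–Pitts–Gabbay rules), stated for an
arbitrary set of freshness constraints. -/
inductive NFresh (Δ : Set (Atom × Var)) : Atom → NTerm → Prop
  | atom {a b : Atom} : a ≠ b → NFresh Δ a (.atom b)
  | susp {a : Atom} {π : NPerm} {X : Var} :
      (permAtom (permInv π) a, X) ∈ Δ → NFresh Δ a (.susp π X)
  | app {a : Atom} {f : Fn} {ts : List NTerm} :
      (∀ t ∈ ts, NFresh Δ a t) → NFresh Δ a (.app f ts)
  | abs1 {a : Atom} {t : NTerm} : NFresh Δ a (.abs a t)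
  | abs2 {a b : Atom} {t : NTerm} : a ≠ b → NFresh Δ a t → NFresh Δ a (.abs b t)

/-- The α-equivalence relation `Δ ⊢ t ≈ s` (Urban–Pitts–Gabbay rules). -/
inductive NAlpha (Δ : Set (Atom × Var)) : NTerm → NTerm → Prop
  | atom (a : Atom) : NAlpha Δ (.atom a) (.atom a)
  | abs1 {a : Atom} {t t' : NTerm} : NAlpha Δ t t' → NAlpha Δ (.abs a t) (.abs a t')
  | abs2 {a b : Atom} {t t' : NTerm} : a ≠ b → NAlpha Δ t (permTerm [(a, b)] t') →
      NFresh Δ a t' → NAlpha Δ (.abs a t) (.abs b t')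
  | susp {π π' : NPerm} {X : Var} :
      (∀ a : Atom, permAtom π a ≠ permAtom π' a → (a, X) ∈ Δ) →
      NAlpha Δ (.susp π X) (.susp π' X)
  | app {f : Fn} {ts ss : List NTerm} : ts.length = ss.length →
      (∀ p ∈ List.zip ts ss, NAlpha Δ p.1 p.2) →
      NAlpha Δ (.app f ts) (.app f ss)

/-- `FA⁻ˢ(t)`: atoms occurring freely in `t`, ignoring suspensions. -/
def FAnoSusp : NTerm → Finset Atom
  | .app _ ts => (ts.attach.map (fun x => FAnoSusp x.1)).foldr (· ∪ ·) ∅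
  | .atom a => {a}
  | .abs a t => FAnoSusp t \ {a}
  | .susp _ _ => ∅
decreasing_by
  all_goals (simp_wf; try omega)
  all_goals (have := List.sizeOf_lt_of_mem x.2; omega)

/-- A substitution respects a freshness context. -/
def Respects (σ : NSubst) (Δ : FCtx) : Prop :=
  ∀ a X, (a, X) ∈ Δ → a ∉ FAnoSusp (σ X)

/-! ### The algorithm FC -/

/-- A finite set of atomic freshness formulas `a # t`. -/
abbrev FProb := Multiset (Atom × NTerm)

/-- One step of the algorithm FC, transforming pairs `(F; Δ)`. -/
inductive FCStep : FProb × FCtx → FProb × FCtx → Prop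
  | del {a b : Atom} {F : FProb} {Δ : FCtx} : a ≠ b →
      FCStep ((a, .atom b) ::ₘ F, Δ) (F, Δ)
  | abs1 {a : Atom} {t : NTerm} {F : FProb} {Δ : FCtx} :
      FCStep ((a, .abs a t) ::ₘ F, Δ) (F, Δ)
  | abs2 {a b : Atom} {t : NTerm} {F : FProb} {Δ : FCtx} : a ≠ b →
      FCStep ((a, .abs b t) ::ₘ F, Δ) ((a, t) ::ₘ F, Δ)
  | dec {a : Atom} {f : Fn} {ts : List NTerm} {F : FProb} {Δ : FCtx} :
      FCStep ((a, .app f ts) ::ₘ F, Δ) (↑(ts.map (fun t => (a, t))) + F, Δ)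
  | sus {a : Atom} {π : NPerm} {X : Var} {F : FProb} {Δ : FCtx} :
      FCStep ((a, .susp π X) ::ₘ F, Δ) (F, insert (permAtom (permInv π) a, X) Δ)

/-- The algorithm FC succeeds on `F` with result `Γ`. -/
def FCReaches (F : FProb) (Γ : FCtx) : Prop :=
  Relation.ReflTransGen FCStep (F, ∅) (0, Γ)

/-- The algorithm FC fails on `F` (reaches a stuck state with remaining formulas). -/
def FCFails (F : FProb) : Prop :=
  ∃ st : FProb × FCtx, Relation.ReflTransGen FCStep (F, ∅) st ∧ st.1 ≠ 0 ∧
    ∀ st', ¬ FCStep st st'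

/-- The freshness problem `{a # Xσ | a#X ∈ Δ}` defining the instance `Δσ`. -/
def ctxSubstProb (Δ : FCtx) (σ : NSubst) : FProb :=
  Δ.val.map (fun c => (c.1, σ c.2))

/-! ### Terms-in-context and the subsumption order -/

/-- A term-in-context. -/
abbrev TIC := FCtx × NTerm

/-- `p ⪯ q`: the term-in-context `p` is more general than `q`.  (The condition
`p.1 σ ⊆ q.1` is expressed, equivalently by the properties of FC, as
`q.1 ⊢ a # Xσ` for all `a # X ∈ p.1`.) -/
def TIC.Le (p q : TIC) : Prop :=
  ∃ σ : NSubst, Respects σ p.1 ∧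
    (∀ c ∈ p.1, NFresh (↑q.1 : Set (Atom × Var)) c.1 (σ c.2)) ∧
    NAlpha (↑q.1 : Set (Atom × Var)) (substTerm σ p.2) q.2

/-- The strict part of `⪯`. -/
def TIC.Lt (p q : TIC) : Prop := TIC.Le p q ∧ ¬ TIC.Le q p

/-- Equi-generality `≃`. -/
def TIC.Equiv (p q : TIC) : Prop := TIC.Le p q ∧ TIC.Le q p

/-- `r` is a generalization of `p₁` and `p₂`. -/
def IsGen (r p₁ p₂ : TIC) : Prop := TIC.Le r p₁ ∧ TIC.Le r p₂

/-! ### Atoms, variables, basedness -/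

def permAtoms : NPerm → Finset Atom
  | [] => ∅
  | (a, b) :: π => insert a (insert b (permAtoms π))

def termAtoms : NTerm → Finset Atom
  | .app _ ts => (ts.attach.map (fun x => termAtoms x.1)).foldr (· ∪ ·) ∅
  | .atom a => {a}
  | .abs a t => insert a (termAtoms t)
  | .susp π _ => permAtoms π
decreasing_by
  all_goals (simp_wf; try omega)
  all_goals (have := List.sizeOf_lt_of_mem x.2; omega)

def termVars : NTerm → Finset Var
  | .app _ ts => (ts.attach.map (fun x => termVars x.1)).foldr (· ∪ ·) ∅
  | .atom _ => ∅
  | .abs _ t => termVars t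
  | .susp _ X => {X}
decreasing_by
  all_goals (simp_wf; try omega)
  all_goals (have := List.sizeOf_lt_of_mem x.2; omega)

/-- `FA(t)`: the atoms occurring freely in `t` (with `FA(π·X) = Atoms(π)`). -/
def termFA : NTerm → Finset Atom
  | .app _ ts => (ts.attach.map (fun x => termFA x.1)).foldr (· ∪ ·) ∅
  | .atom a => {a}
  | .abs a t => termFA t \ {a}
  | .susp π _ => permAtoms π
decreasing_by
  all_goals (simp_wf; try omega)
  all_goals (have := List.sizeOf_lt_of_mem x.2; omega)

def ctxAtoms (Δ : FCtx) : Finset Atom := Δ.image Prod.fst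
def ctxVars (Δ : FCtx) : Finset Var := Δ.image Prod.snd

def permBased (π : NPerm) (A : Finset Atom) : Prop := permAtoms π ⊆ A
def termBased (t : NTerm) (A : Finset Atom) : Prop := termAtoms t ⊆ A
def ctxBased (Δ : FCtx) (A : Finset Atom) : Prop := ctxAtoms Δ ⊆ A
def ticBased (p : TIC) (A : Finset Atom) : Prop := ctxBased p.1 A ∧ termBased p.2 A

/-- The number of abstraction occurrences in a term. -/
def absCount : NTerm → ℕ
  | .app _ ts => (ts.attach.map (fun x => absCount x.1)).sum
  | .atom _ => 0
  | .abs _ t => absCount t + 1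
  | .susp _ _ => 0
decreasing_by
  all_goals (simp_wf; try omega)
  all_goals (have := List.sizeOf_lt_of_mem x.2; omega)

/-! ### The nominal anti-unification algorithm 𝔑 -/

/-- Anti-unification triple `X : t ≜ s`. -/
abbrev AUT := Var × NTerm × NTerm

/-- A state of the algorithm 𝔑: the unsolved triples `P`, the store `S`, the
freshness context `Γ`, the substitution `σ`, and the set `V` of variables used
so far (needed to express freshness of the generated variables). -/
structure NState where
  P : Multiset AUT
  S : Multiset AUT
  Γ : FCtx
  σ : NSubst
  V : Finset Var

/-- `σ{X ↦ u}`. -/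
def updSubst (σ : NSubst) (X : Var) (u : NTerm) : NSubst :=
  substComp σ (fun Z => if Z = X then u else .susp [] Z)

/-- The head of a term (a function symbol together with its arity, an atom, the
abstraction operator, or a variable). -/
inductive NHead where
  | fn : Fn → ℕ → NHead
  | atom : Atom → NHead
  | abs : NHead
  | var : Var → NHead
deriving DecidableEq

def headOf : NTerm → NHead
  | .app f ts => .fn f ts.length
  | .atom a => .atom a
  | .abs _ _ => .abs
  | .susp _ X => .var X

def IsSusp : NTerm → Prop
  | .susp _ _ => True
  | _ => False

def IsAbs : NTerm → Prop
  | .abs _ _ => True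
  | _ => False

/-- The applicability condition of the rule Sol. -/
def SolCond (A : Finset Atom) (Δ : FCtx) (t s : NTerm) : Prop :=
  headOf t ≠ headOf s ∨ (IsSusp t ∧ IsSusp s) ∨
    (IsAbs t ∧ IsAbs s ∧
      ¬ ∃ c ∈ A, NFresh (↑Δ : Set (Atom × Var)) c t ∧ NFresh (↑Δ : Set (Atom × Var)) c s)

open Classical in
/-- `{a # X | a ∈ A, Δ ⊢ a # t, Δ ⊢ a # s}`. -/
noncomputable def solSet (A : Finset Atom) (Δ : FCtx) (t s : NTerm) (X : Var) : FCtx :=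
  (A.filter (fun a =>
    NFresh (↑Δ : Set (Atom × Var)) a t ∧ NFresh (↑Δ : Set (Atom × Var)) a s)).image
    (fun a => (a, X))

/-- `Γ{Y ↦ π·X}` on a freshness context. -/
def ctxRename (Γ : FCtx) (Y : Var) (π : NPerm) (X : Var) : FCtx :=
  Γ.image (fun c => if c.2 = Y then (permAtom (permInv π) c.1, X) else c)

/-- One step of the algorithm 𝔑, with global parameters `A` and `Δ`. -/
inductive NStep (A : Finset Atom) (Δ : FCtx) : NState → NState → Prop
  | decApp {X : Var} {f : Fn} {ts ss : List NTerm} {P S : Multiset AUT} {Γ : FCtx}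
      {σ : NSubst} {V : Finset Var} (Ys : List Var) :
      ts.length = ss.length → Ys.length = ts.length → Ys.Nodup →
      (∀ Y ∈ Ys, Y ∉ V) →
      NStep A Δ ⟨(X, .app f ts, .app f ss) ::ₘ P, S, Γ, σ, V⟩
        ⟨↑(List.zipWith (fun Y p => (Y, p)) Ys (List.zip ts ss)) + P, S, Γ,
         updSubst σ X (.app f (Ys.map (fun Y => .susp [] Y))), V ∪ Ys.toFinset⟩
  | decAtom {X : Var} {a : Atom} {P S : Multiset AUT} {Γ : FCtx} {σ : NSubst}
      {V : Finset Var} :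
      NStep A Δ ⟨(X, .atom a, .atom a) ::ₘ P, S, Γ, σ, V⟩
        ⟨P, S, Γ, updSubst σ X (.atom a), V⟩
  | abs {X : Var} {a b : Atom} {t s : NTerm} {P S : Multiset AUT} {Γ : FCtx}
      {σ : NSubst} {V : Finset Var} (Y : Var) (c : Atom) :
      Y ∉ V → c ∈ A →
      NFresh (↑Δ : Set (Atom × Var)) c (.abs a t) →
      NFresh (↑Δ : Set (Atom × Var)) c (.abs b s) →
      NStep A Δ ⟨(X, .abs a t, .abs b s) ::ₘ P, S, Γ, σ, V⟩
        ⟨(Y, permTerm [(c, a)] t, permTerm [(c, b)] s) ::ₘ P, S, Γ,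
         updSubst σ X (.abs c (.susp [] Y)), insert Y V⟩
  | sol {X : Var} {t s : NTerm} {P S : Multiset AUT} {Γ : FCtx} {σ : NSubst}
      {V : Finset Var} :
      SolCond A Δ t s →
      NStep A Δ ⟨(X, t, s) ::ₘ P, S, Γ, σ, V⟩
        ⟨P, (X, t, s) ::ₘ S, Γ ∪ solSet A Δ t s X, σ, V⟩
  | mer {X Y : Var} {t₁ s₁ t₂ s₂ : NTerm} {P S : Multiset AUT} {Γ : FCtx}
      {σ : NSubst} {V : Finset Var} (π : NPerm) :
      X ≠ Y →
      permBased π (termAtoms t₁ ∪ termAtoms s₁ ∪ termAtoms t₂ ∪ termAtoms s₂) →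
      NAlpha (↑Δ : Set (Atom × Var)) (permTerm π t₁) t₂ →
      NAlpha (↑Δ : Set (Atom × Var)) (permTerm π s₁) s₂ →
      NStep A Δ ⟨P, (X, t₁, s₁) ::ₘ (Y, t₂, s₂) ::ₘ S, Γ, σ, V⟩
        ⟨P, (X, t₁, s₁) ::ₘ S, ctxRename Γ Y π X, updSubst σ Y (.susp π X), V⟩

/-- The initial state of 𝔑 on the triple `X : t ≜ s`. -/
def initNState (X : Var) (t s : NTerm) (Δ : FCtx) : NState :=
  ⟨{(X, t, s)}, 0, ∅, idSubst, insert X (termVars t ∪ termVars s ∪ ctxVars Δ)⟩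

/-- An `A`-based least general generalization of `p₁` and `p₂`. -/
def IsABasedLgg (A : Finset Atom) (p p₁ p₂ : TIC) : Prop :=
  ticBased p A ∧ IsGen p p₁ p₂ ∧
    ¬ ∃ p' : TIC, ticBased p' A ∧ IsGen p' p₁ p₂ ∧ TIC.Lt p p'

/-! ### The equivariance algorithm 𝔈 -/

/-- A set of equivariance equations `t ≈ s`. -/
abbrev EProb := Multiset (NTerm × NTerm)

def eqsAtoms (E : EProb) : Finset Atom :=
  (E.map (fun e => termAtoms e.1 ∪ termAtoms e.2)).sup

def eqsVars (E : EProb) : Finset Var :=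
  (E.map (fun e => termVars e.1 ∪ termVars e.2)).sup

/-- All equations of `E` are equations between atoms. -/
def AtomEqs (E : EProb) : Prop := ∀ e ∈ E, ∃ a b : Atom, e = (NTerm.atom a, NTerm.atom b)

/-- One step of the equivariance algorithm 𝔈 (with fixed freshness context `Δ`) on
states `(E; A; π)`.  The first-phase rules require `π = Id`; the second-phase
rules require that only equations between atoms are left. -/
inductive EStep (Δ : FCtx) :
    EProb × Finset Atom × NPerm → EProb × Finset Atom × NPerm → Prop
  | dec {f : Fn} {ts ss : List NTerm} {E : EProb} {A : Finset Atom} :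
      ts.length = ss.length →
      EStep Δ ((.app f ts, .app f ss) ::ₘ E, A, []) (↑(List.zip ts ss) + E, A, [])
  | alp {a b : Atom} {t s : NTerm} {E : EProb} {A : Finset Atom} (c : Atom) :
      c ∉ A → c ∉ eqsAtoms ((.abs a t, .abs b s) ::ₘ E) → c ∉ ctxAtoms Δ →
      EStep Δ ((.abs a t, .abs b s) ::ₘ E, A, [])
        ((permTerm [(c, a)] t, permTerm [(c, b)] s) ::ₘ E, A, [])
  | sus {π₁ π₂ : NPerm} {X : Var} {E : EProb} {A : Finset Atom} :
      EStep Δ ((.susp π₁ X, .susp π₂ X) ::ₘ E, A, [])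
        (↑((A.filter (fun a => (a, X) ∉ Δ)).toList.map
            (fun a => (NTerm.atom (permAtom π₁ a), NTerm.atom (permAtom π₂ a)))) + E,
         A, [])
  | rem {a b : Atom} {E : EProb} {A : Finset Atom} {π : NPerm} :
      AtomEqs ((.atom a, .atom b) ::ₘ E) → permAtom π a = b →
      EStep Δ ((.atom a, .atom b) ::ₘ E, A, π) (E, A.erase b, π)
  | sol {a b : Atom} {E : EProb} {A : Finset Atom} {π : NPerm} :
      AtomEqs ((.atom a, .atom b) ::ₘ E) →
      permAtom π a ∈ A → b ∈ A → permAtom π a ≠ b →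
      EStep Δ ((.atom a, .atom b) ::ₘ E, A, π) (E, A.erase b, (permAtom π a, b) :: π)

/-! ### Interpretation of terms in context as de Bruijn terms

Two terms are α-equivalent under `Δ` iff they have the same interpretation, whence
transitivity. -/

/-- De Bruijn terms whose variables are maps from atoms to indices. -/
inductive DBTerm where
  | app : Fn → List DBTerm → DBTerm
  | idx : ℕ → DBTerm
  | abs : DBTerm → DBTerm
  | susp : (Atom → Option ℕ) → Var → DBTerm

/-- The environment `ρ` pushed under a binder of `a`. -/
def liftEnv (a : Atom) (ρ : Atom → ℕ) (c : Atom) : ℕ := if c = a then 0 else ρ c + 1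

open Classical in
/-- The interpretation of a nominal term; at a suspension on `X` the atoms known to be
fresh for `X` are disregarded. -/
noncomputable def interp (Δ : Set (Atom × Var)) (ρ : Atom → ℕ) : NTerm → DBTerm
  | .app f ts => .app f (ts.attach.map (fun x => interp Δ ρ x.1))
  | .atom a => .idx (ρ a)
  | .abs a t => .abs (interp Δ (liftEnv a ρ) t)
  | .susp π X => .susp (fun a => if (a, X) ∈ Δ then none else some (ρ (permAtom π a))) X
termination_by t => sizeOf t
decreasing_by
  all_goals (simp_wf; try omega)
  all_goals (have := List.sizeOf_lt_of_mem x.2; omega)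

/-- The index `n` does not occur freely in a de Bruijn term. -/
inductive IdxFresh : ℕ → DBTerm → Prop
  | app {n : ℕ} {f : Fn} {ds : List DBTerm} : (∀ d ∈ ds, IdxFresh n d) → IdxFresh n (.app f ds)
  | idx {n m : ℕ} : n ≠ m → IdxFresh n (.idx m)
  | abs {n : ℕ} {d : DBTerm} : IdxFresh (n + 1) d → IdxFresh n (.abs d)
  | susp {n : ℕ} {g : Atom → Option ℕ} {X : Var} : (∀ a, g a ≠ some n) → IdxFresh n (.susp g X)

theorem NTerm.inductionOn {P : NTerm → Prop} (t : NTerm)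
    (app : ∀ f ts, (∀ t ∈ ts, P t) → P (.app f ts)) (atom : ∀ a, P (.atom a))
    (abs : ∀ a t, P t → P (.abs a t)) (susp : ∀ π X, P (.susp π X)) : P t :=
  NTerm.rec (motive_1 := P) (motive_2 := fun ts => ∀ t ∈ ts, P t)
    app atom abs susp (by simp) (fun _ _ h hs => by simpa using ⟨h, hs⟩) t

theorem interp_app (Δ : Set (Atom × Var)) (ρ : Atom → ℕ) (f : Fn) (ts : List NTerm) :
    interp Δ ρ (.app f ts) = .app f (ts.map (interp Δ ρ)) := by
  rw [interp]; simp

theorem permTerm_app (π : NPerm) (f : Fn) (ts : List NTerm) :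
    permTerm π (.app f ts) = .app f (ts.map (permTerm π)) := by
  rw [permTerm]; simp

theorem swapAtom_swapAtom (a b c : Atom) : swapAtom a b (swapAtom a b c) = c := by
  unfold swapAtom; grind

theorem permAtom_append (π π' : NPerm) (c : Atom) :
    permAtom (π ++ π') c = permAtom π (permAtom π' c) := by
  induction π with
  | nil => rfl
  | cons p π ih => simp [permAtom, ih]

theorem permAtom_permInv (π : NPerm) (c : Atom) : permAtom (permInv π) (permAtom π c) = c := by
  induction π with
  | nil => rfl
  | cons p π ih =>
    simp only [permInv, List.reverse_cons, permAtom_append, permAtom, swapAtom_swapAtom] at ih ⊢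
    exact ih

theorem permAtom_permInv' (π : NPerm) (c : Atom) : permAtom π (permAtom (permInv π) c) = c := by
  simpa [permInv] using permAtom_permInv (permInv π) c

theorem permAtom_injective (π : NPerm) : Function.Injective (permAtom π) :=
  Function.LeftInverse.injective (permAtom_permInv π)

theorem liftEnv_injective (a : Atom) {ρ : Atom → ℕ} (hρ : Function.Injective ρ) :
    Function.Injective (liftEnv a ρ) := by
  intro c d h
  have := @hρ c d
  unfold liftEnv at h
  grind

theorem liftEnv_comp_permAtom (π : NPerm) (a : Atom) (ρ : Atom → ℕ) :
    liftEnv (permAtom π a) ρ ∘ permAtom π = liftEnv a (ρ ∘ permAtom π) := by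
  funext c
  simp [liftEnv, (permAtom_injective π).eq_iff]

theorem interp_permTerm (Δ : Set (Atom × Var)) (π : NPerm) (t : NTerm) :
    ∀ ρ, interp Δ ρ (permTerm π t) = interp Δ (ρ ∘ permAtom π) t := by
  induction t using NTerm.inductionOn with
  | app f ts ih =>
    intro ρ
    simp only [permTerm_app, interp_app, List.map_map, DBTerm.app.injEq, true_and]
    exact List.map_congr_left fun t ht => ih t ht ρ
  | atom a => intro ρ; simp [permTerm, interp]
  | abs a t ih => intro ρ; simp [permTerm, interp, ih, liftEnv_comp_permAtom]
  | susp π' X => intro ρ; simp [permTerm, interp, permAtom_append]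

theorem interp_congr {Δ : Set (Atom × Var)} (t : NTerm) :
    ∀ ρ ρ' : Atom → ℕ, (∀ a, ρ a ≠ ρ' a → NFresh Δ a t) → interp Δ ρ t = interp Δ ρ' t := by
  induction t using NTerm.inductionOn with
  | app f ts ih =>
    intro ρ ρ' h
    simp only [interp_app, DBTerm.app.injEq, true_and]
    refine List.map_congr_left fun t ht => ih t ht ρ ρ' fun a ha => ?_
    cases h a ha with
    | app h => exact h t ht
  | atom a =>
    intro ρ ρ' h
    simp only [interp, DBTerm.idx.injEq]
    by_contra ha
    cases h a ha with
    | atom h => exact h rfl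
  | abs b t ih =>
    intro ρ ρ' h
    simp only [interp, DBTerm.abs.injEq]
    refine ih _ _ fun a ha => ?_
    have hab : a ≠ b := fun hab => ha (by simp [liftEnv, hab])
    cases h a (fun h => ha (by simp [liftEnv, hab, h])) with
    | abs1 => exact absurd rfl hab
    | abs2 _ h => exact h
  | susp π X =>
    intro ρ ρ' h
    simp only [interp, DBTerm.susp.injEq, and_true]
    funext a
    by_cases ha : ρ (permAtom π a) = ρ' (permAtom π a)
    · rw [ha]
    · cases h _ ha with
      | susp h => rw [permAtom_permInv] at h; simp [h]

theorem liftEnv_comp_swap_of_ne {a b c : Atom} (hc : c ≠ a) (ρ : Atom → ℕ) :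
    (liftEnv a ρ ∘ permAtom [(a, b)]) c = liftEnv b ρ c := by
  simp only [Function.comp, permAtom, liftEnv, swapAtom]
  grind

theorem interp_swap {Δ : Set (Atom × Var)} {a b : Atom} {t : NTerm}
    (ht : NFresh Δ a t) (ρ : Atom → ℕ) :
    interp Δ (liftEnv a ρ) (permTerm [(a, b)] t) = interp Δ (liftEnv b ρ) t := by
  rw [interp_permTerm]
  refine interp_congr t _ _ fun c hc => ?_
  by_cases hca : c = a
  · exact hca ▸ ht
  · exact absurd (liftEnv_comp_swap_of_ne hca ρ) hc

theorem NAlpha.interp_eq {Δ : Set (Atom × Var)} {t s : NTerm} (h : NAlpha Δ t s) :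
    ∀ ρ, interp Δ ρ t = interp Δ ρ s := by
  induction h with
  | atom a => intro ρ; rfl
  | abs1 _ ih => intro ρ; simp only [interp, ih]
  | abs2 _ _ ht ih => intro ρ; simp only [interp, ih, interp_swap ht]
  | @susp π π' X h =>
    intro ρ
    simp only [interp, DBTerm.susp.injEq, and_true]
    funext a
    by_cases ha : permAtom π a = permAtom π' a
    · rw [ha]
    · simp [h a ha]
  | @app f ts ss hl _ ih =>
    intro ρ
    simp only [interp_app, DBTerm.app.injEq, true_and]
    refine List.ext_getElem (by simpa using hl) fun i h₁ h₂ => ?_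
    simp only [List.length_map] at h₁ h₂
    simpa using ih (ts[i], ss[i])
      (List.mem_iff_getElem.2 ⟨i, by simp [h₁, h₂], by simp⟩) ρ

theorem idxFresh_interp_of_notMem_range (Δ : Set (Atom × Var)) (t : NTerm) :
    ∀ (ρ : Atom → ℕ) (n : ℕ), (∀ a, n ≠ ρ a) → IdxFresh n (interp Δ ρ t) := by
  induction t using NTerm.inductionOn with
  | app f ts ih =>
    intro ρ n h
    rw [interp_app]
    refine .app fun d hd => ?_
    obtain ⟨t, ht, rfl⟩ := List.mem_map.1 hd
    exact ih t ht ρ n h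
  | atom a => intro ρ n h; rw [interp]; exact .idx (h a)
  | abs b t ih =>
    intro ρ n h
    rw [interp]
    refine .abs (ih _ _ fun a => ?_)
    have := h a
    unfold liftEnv
    split <;> omega
  | susp π X =>
    intro ρ n h
    rw [interp]
    refine .susp fun a => ?_
    split <;> simp [(h _).symm]

theorem NFresh.of_idxFresh_interp {Δ : Set (Atom × Var)} {a : Atom} (t : NTerm) :
    ∀ ρ : Atom → ℕ, IdxFresh (ρ a) (interp Δ ρ t) → NFresh Δ a t := by
  induction t using NTerm.inductionOn with
  | app f ts ih =>
    intro ρ h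
    rw [interp_app] at h
    cases h with
    | app h => exact .app fun t ht => ih t ht ρ (h _ (List.mem_map_of_mem ht))
  | atom b =>
    intro ρ h
    rw [interp] at h
    cases h with
    | idx h => exact .atom fun hab => h (hab ▸ rfl)
  | abs b t ih =>
    intro ρ h
    rw [interp] at h
    cases h with
    | abs h =>
      by_cases hab : a = b
      · exact hab ▸ .abs1
      · exact .abs2 hab (ih (liftEnv b ρ) (by simpa [liftEnv, hab] using h))
  | susp π X =>
    intro ρ h
    rw [interp] at h
    cases h with
    | susp h =>
      refine .susp ?_
      by_contra ha
      exact h (permAtom (permInv π) a) (by simp [ha, permAtom_permInv'])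

theorem NAlpha.of_interp_eq {Δ : Set (Atom × Var)} (t : NTerm) :
    ∀ (s : NTerm) (ρ : Atom → ℕ), Function.Injective ρ → interp Δ ρ t = interp Δ ρ s →
      NAlpha Δ t s := by
  induction t using NTerm.inductionOn with
  | app f ts ih =>
    intro s ρ hρ h
    cases s <;> simp only [interp_app, interp, reduceCtorEq, DBTerm.app.injEq] at h
    obtain ⟨rfl, h⟩ := h
    refine .app (by simpa using congrArg List.length h) fun p hp => ?_
    obtain ⟨i, hi, rfl⟩ := List.mem_iff_getElem.1 hp
    simp only [List.length_zip, lt_inf_iff] at hi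
    have hget := List.getElem_of_eq h (i := i) (by simpa using hi.1)
    simp only [List.getElem_map] at hget
    simpa using ih _ (List.getElem_mem hi.1) _ ρ hρ hget
  | atom a =>
    intro s ρ hρ h
    cases s <;> simp only [interp_app, interp, reduceCtorEq, DBTerm.idx.injEq] at h
    exact hρ h ▸ .atom a
  | abs a t ih =>
    intro s ρ hρ h
    cases s <;> simp only [interp_app, interp, reduceCtorEq, DBTerm.abs.injEq] at h
    rename_i b t'
    by_cases hab : a = b
    · subst hab
      exact .abs1 (ih t' _ (liftEnv_injective a hρ) h)
    · have hfresh : NFresh Δ a t' := by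
        refine .of_idxFresh_interp t' (liftEnv b ρ) ?_
        rw [← h]
        refine idxFresh_interp_of_notMem_range Δ t _ _ fun c => ?_
        have := @hρ a c
        simp only [liftEnv]
        grind
      exact .abs2 hab (ih _ _ (liftEnv_injective a hρ) (h.trans (interp_swap hfresh ρ).symm))
        hfresh
  | susp π X =>
    intro s ρ hρ h
    cases s <;> simp only [interp_app, interp, reduceCtorEq, DBTerm.susp.injEq] at h
    obtain ⟨h, rfl⟩ := h
    refine .susp fun a ha => ?_
    by_contra hX
    have := congrFun h a
    simp only [hX, if_false, Option.some.injEq] at this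
    exact ha (hρ this)

/-- α-equivalence under a freshness context is transitive. -/
theorem alpha_trans (Δ : FCtx) (t s u : NTerm)
    (h1 : NAlpha (↑Δ : Set (Atom × Var)) t s)
    (h2 : NAlpha (↑Δ : Set (Atom × Var)) s u) :
    NAlpha (↑Δ : Set (Atom × Var)) t u := by
  exact .of_interp_eq t u id Function.injective_id ((h1.interp_eq id).trans (h2.interp_eq id))
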